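/- Suppose η = Σ_{r∈Σ_R} p_r K_r^{−α_min} < 1 and let β ∈ (α_min,γ) ∩ (0,1], t₁ = α_min+1−β, t₂ = 1−β. Then for all sufficiently large a₁, a₂ > 0 the Perron–Frobenius operator P preserves the set C₂(a₁,a₂,β): if f ∈ C₁ satisfies f(x) ≤ a₁ x^{−t₁} on (0,1/2], f(x) ≤ a₂ (x−1/2)^{−t₂} on (1/2,1] and ∫₀¹ f dλ = 1, then Pf satisfies the same three conditions. -/

import Mathlib

open MeasureTheory Set

/-- Left branch of the LSV-type maps: `x ↦ x(1 + 2^α x^α)`. -/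
noncomputable def lsvLeft (α x : ℝ) : ℝ := x * (1 + 2 ^ α * x ^ α)

/-- The LSV map `S_α`. -/
noncomputable def lsvMap (α : ℝ) (x : ℝ) : ℝ :=
  if x ≤ 1 / 2 then lsvLeft α x else 2 * x - 1

/-- The map `R_{α,K}`. -/
noncomputable def rMap (α K : ℝ) (x : ℝ) : ℝ :=
  if x ≤ 1 / 2 then lsvLeft α x
  else 1 / 2 + K * (x - 1 / 2) + 2 * (1 - K) * (x - 1 / 2) ^ 2

/-- The Perron–Frobenius operator `P` of the random system, written in terms of
the inverse `y j` of the left branch of `T j`, the inverse `zr r` of the right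
branch of `T r` (for `r ∈ SR`), and `z(x) = (x+1)/2`.  Here
`ξ_j(x) = (2 y_j(x))^{α_j}` and `DR_r(u) = K_r + 4(1-K_r)(u - 1/2)`. -/
noncomputable def PFop {N : ℕ} (SR : Finset (Fin N)) (p α K : Fin N → ℝ)
    (y zr : Fin N → ℝ → ℝ) (f : ℝ → ℝ) (x : ℝ) : ℝ :=
  (∑ j, p j * (f (y j x) / (1 + (α j + 1) * (2 * y j x) ^ (α j))))
    + (∑ j ∈ SRᶜ, p j) * (f ((x + 1) / 2) / 2)
    + if 1 / 2 < x then
        ∑ r ∈ SR, p r * (f (zr r x) / (K r + 4 * (1 - K r) * (zr r x - 1 / 2)))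
      else 0

/-- Membership of the set `C₀`: nonnegative, decreasing and continuous on
`(0,1/2]` and on `(1/2,1]`, and Lebesgue integrable. -/
def memC0 (f : ℝ → ℝ) : Prop :=
  (∀ x ∈ Set.Ioc (0 : ℝ) 1, 0 ≤ f x) ∧
  AntitoneOn f (Set.Ioc (0 : ℝ) (1 / 2)) ∧
  ContinuousOn f (Set.Ioc (0 : ℝ) (1 / 2)) ∧
  AntitoneOn f (Set.Ioc (1 / 2 : ℝ) 1) ∧
  ContinuousOn f (Set.Ioc (1 / 2 : ℝ) 1) ∧
  MeasureTheory.IntegrableOn f (Set.Ioc (0 : ℝ) 1)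


/-- Membership of the set `C₁`: member of `C₀` such that `x ↦ x^d f(x)` is
increasing on `(0,1/2]` and `x ↦ (x-1/2)^d f(x)` is increasing on `(1/2,1]`. -/
def memC1 (d : ℝ) (f : ℝ → ℝ) : Prop :=
  memC0 f ∧
  MonotoneOn (fun x => x ^ d * f x) (Set.Ioc (0 : ℝ) (1 / 2)) ∧
  MonotoneOn (fun x => (x - 1 / 2) ^ d * f x) (Set.Ioc (1 / 2 : ℝ) 1)

/-- Membership of the set `C₂(a₁,a₂,β)` (with `t₁ = α_min + 1 - β`,
`t₂ = 1 - β`): member of `C₁` with `f(x) ≤ a₁ x^{-t₁}` on `(0,1/2]`,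
`f(x) ≤ a₂ (x-1/2)^{-t₂}` on `(1/2,1]` and `∫₀¹ f dλ = 1`. -/
def memC2 (d t₁ t₂ a₁ a₂ : ℝ) (f : ℝ → ℝ) : Prop :=
  memC1 d f ∧
  (∀ x ∈ Set.Ioc (0 : ℝ) (1 / 2), f x ≤ a₁ * x ^ (-t₁)) ∧
  (∀ x ∈ Set.Ioc (1 / 2 : ℝ) 1, f x ≤ a₂ * (x - 1 / 2) ^ (-t₂)) ∧
  ∫ x in Set.Ioc (0 : ℝ) 1, f x = 1

/-- `ψ` inverts the expanding increasing branch `φ : s → t`, whose derivative is `D`. -/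
structure IsInverseBranch (φ D ψ : ℝ → ℝ) (s t : Set ℝ) (c : ℝ) : Prop where
  c_pos : 0 < c
  mapsTo : MapsTo φ s t
  mapsTo_inv : MapsTo ψ t s
  right_inv : ∀ x ∈ t, φ (ψ x) = x
  expand : ∀ u ∈ s, ∀ v ∈ s, u ≤ v → c * (v - u) ≤ φ v - φ u
  hasDerivAt : ∀ u ∈ s, HasDerivAt φ (D u) u
  D_pos : ∀ u ∈ s, 0 < D u
  D_mono : MonotoneOn D s
  D_cont : ContinuousOn D s

namespace IsInverseBranch

variable {φ D ψ : ℝ → ℝ} {s t : Set ℝ} {c : ℝ}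

theorem injOn (h : IsInverseBranch φ D ψ s t c) : InjOn φ s := by
  intro u hu v hv huv
  have hc := h.c_pos
  rcases le_total u v with huv' | huv'
  · have := h.expand u hu v hv huv'
    have : v - u ≤ 0 := by
      by_contra! hlt
      nlinarith [mul_pos hc hlt]
    linarith
  · have := h.expand v hv u hu huv'
    have : u - v ≤ 0 := by
      by_contra! hlt
      nlinarith [mul_pos hc hlt]
    linarith

theorem left_inv (h : IsInverseBranch φ D ψ s t c) {u : ℝ} (hu : u ∈ s) : ψ (φ u) = u :=
  h.injOn (h.mapsTo_inv (h.mapsTo hu)) hu (h.right_inv _ (h.mapsTo hu))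

theorem image_eq (h : IsInverseBranch φ D ψ s t c) : φ '' s = t :=
  Subset.antisymm h.mapsTo.image_subset fun x hx => ⟨ψ x, h.mapsTo_inv hx, h.right_inv x hx⟩

theorem monotoneOn_inv (h : IsInverseBranch φ D ψ s t c) : MonotoneOn ψ t := by
  intro a ha b hb hab
  by_contra! hlt
  have := h.expand _ (h.mapsTo_inv hb) _ (h.mapsTo_inv ha) hlt.le
  rw [h.right_inv a ha, h.right_inv b hb] at this
  nlinarith [mul_pos h.c_pos (sub_pos.2 hlt)]

theorem continuousOn_inv (h : IsInverseBranch φ D ψ s t c) : ContinuousOn ψ t := by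
  have hc := h.c_pos
  have key : ∀ a ∈ t, ∀ b ∈ t, a ≤ b → |ψ a - ψ b| ≤ c⁻¹ * |a - b| := by
    intro a ha b hb hab
    have h1 := h.monotoneOn_inv ha hb hab
    have h2 := h.expand _ (h.mapsTo_inv ha) _ (h.mapsTo_inv hb) h1
    rw [h.right_inv a ha, h.right_inv b hb] at h2
    rw [abs_sub_comm, abs_of_nonneg (sub_nonneg.2 h1), abs_sub_comm a,
      abs_of_nonneg (sub_nonneg.2 hab), inv_mul_eq_div, le_div_iff₀ hc]
    linarith
  have : LipschitzOnWith (Real.toNNReal c⁻¹) ψ t := by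
    refine LipschitzOnWith.of_dist_le_mul fun a ha b hb => ?_
    rw [Real.coe_toNNReal _ (inv_pos.2 hc).le, Real.dist_eq, Real.dist_eq]
    rcases le_total a b with hab | hab
    · exact key a ha b hb hab
    · rw [abs_sub_comm, abs_sub_comm a]
      exact key b hb a ha hab
  exact this.continuousOn

variable {f : ℝ → ℝ}

theorem nonneg (h : IsInverseBranch φ D ψ s t c) (hf : ∀ u ∈ s, 0 ≤ f u) :
    ∀ x ∈ t, 0 ≤ f (ψ x) / D (ψ x) := fun _ hx =>
  div_nonneg (hf _ (h.mapsTo_inv hx)) (h.D_pos _ (h.mapsTo_inv hx)).le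

theorem antitoneOn (h : IsInverseBranch φ D ψ s t c) (hf0 : ∀ u ∈ s, 0 ≤ f u)
    (hf : AntitoneOn f s) : AntitoneOn (fun x => f (ψ x) / D (ψ x)) t := by
  intro a ha b hb hab
  have hψ := h.monotoneOn_inv ha hb hab
  have ha' := h.mapsTo_inv ha
  have hb' := h.mapsTo_inv hb
  exact div_le_div₀ (hf0 _ ha') (hf ha' hb' hψ) (h.D_pos _ ha') (h.D_mono ha' hb' hψ)

theorem continuousOn (h : IsInverseBranch φ D ψ s t c) (hf : ContinuousOn f s) :
    ContinuousOn (fun x => f (ψ x) / D (ψ x)) t :=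
  (hf.comp h.continuousOn_inv h.mapsTo_inv).div (h.D_cont.comp h.continuousOn_inv h.mapsTo_inv)
    fun _ hx => (h.D_pos _ (h.mapsTo_inv hx)).ne'

theorem abs_deriv_smul_eqOn (h : IsInverseBranch φ D ψ s t c) :
    EqOn (fun u => |D u| • (fun x => f (ψ x) / D (ψ x)) (φ u)) f s := by
  intro u hu
  have hD := h.D_pos u hu
  simp only [h.left_inv hu, abs_of_pos hD, smul_eq_mul]
  field_simp

theorem integrableOn (h : IsInverseBranch φ D ψ s t c) (hs : MeasurableSet s)
    (hf : IntegrableOn f s) : IntegrableOn (fun x => f (ψ x) / D (ψ x)) t := by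
  rw [← h.image_eq, integrableOn_image_iff_integrableOn_abs_deriv_smul hs
    (fun u hu => (h.hasDerivAt u hu).hasDerivWithinAt) h.injOn]
  exact hf.congr_fun h.abs_deriv_smul_eqOn.symm hs

theorem integral_eq (h : IsInverseBranch φ D ψ s t c) (hs : MeasurableSet s) :
    ∫ x in t, f (ψ x) / D (ψ x) = ∫ u in s, f u := by
  rw [← h.image_eq, integral_image_eq_integral_abs_deriv_smul hs
    (fun u hu => (h.hasDerivAt u hu).hasDerivWithinAt) h.injOn]
  exact setIntegral_congr_fun hs h.abs_deriv_smul_eqOn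

theorem monotoneOn_weighted (h : IsInverseBranch φ D ψ s t c) {w w' q : ℝ → ℝ}
    (hf0 : ∀ u ∈ s, 0 ≤ w u * f u) (hf : MonotoneOn (fun u => w u * f u) s)
    (hq0 : ∀ u ∈ s, 0 ≤ q u) (hq : MonotoneOn q s)
    (hw : ∀ u ∈ s, w' (φ u) = w u * (q u * D u)) :
    MonotoneOn (fun x => w' x * (f (ψ x) / D (ψ x))) t := by
  have key : ∀ x ∈ t, w' x * (f (ψ x) / D (ψ x)) = w (ψ x) * f (ψ x) * q (ψ x) := by
    intro x hx
    have hD := (h.D_pos _ (h.mapsTo_inv hx)).ne'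
    have := hw _ (h.mapsTo_inv hx)
    rw [h.right_inv x hx] at this
    rw [this]
    field_simp
  intro a ha b hb hab
  have hψ := h.monotoneOn_inv ha hb hab
  have ha' := h.mapsTo_inv ha
  have hb' := h.mapsTo_inv hb
  simp only [key a ha, key b hb]
  exact mul_le_mul (hf ha' hb' hψ) (hq ha' hb' hψ) (hq0 _ ha') (hf0 _ hb')

end IsInverseBranch

theorem rpow_add_div_le {k b d w₁ w₂ : ℝ} (hk : 0 < k) (hb : 1 ≤ b) (hbd : b ≤ d)
    (hw₁ : 0 ≤ w₁) (hw : w₁ ≤ w₂) :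
    (k + w₁) ^ d / (k + b * w₁) ≤ (k + w₂) ^ d / (k + b * w₂) := by
  have h1 : 0 < k + w₁ := by linarith
  have h1' : 0 < k + b * w₁ := by positivity
  have h2' : 0 < k + b * w₂ := by
    have : 0 ≤ w₂ := hw₁.trans hw
    positivity
  have hs : 0 ≤ (w₂ - w₁) / (k + w₁) := div_nonneg (by linarith) h1.le
  have hB := one_add_mul_self_le_rpow_one_add (s := (w₂ - w₁) / (k + w₁)) (by linarith)
    (hb.trans hbd)
  have hfac : k + w₂ = (k + w₁) * (1 + (w₂ - w₁) / (k + w₁)) := by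
    field_simp
    ring
  have hlin : k + b * w₂ ≤ (1 + d * ((w₂ - w₁) / (k + w₁))) * (k + b * w₁) := by
    have e : b * (w₂ - w₁) ≤ d * ((w₂ - w₁) / (k + w₁)) * (k + b * w₁) := by
      have e1 : w₂ - w₁ = (w₂ - w₁) / (k + w₁) * (k + w₁) := by field_simp
      calc b * (w₂ - w₁) = b * ((w₂ - w₁) / (k + w₁)) * (k + w₁) := by
            rw [mul_assoc, ← e1]
        _ ≤ d * ((w₂ - w₁) / (k + w₁)) * (k + b * w₁) := by
            gcongr
            · exact mul_nonneg (by linarith) hs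
            · nlinarith
    linarith
  have hpow : (k + w₂) ^ d = (k + w₁) ^ d * (1 + (w₂ - w₁) / (k + w₁)) ^ d := by
    rw [← Real.mul_rpow h1.le (by linarith), ← hfac]
  rw [div_le_div_iff₀ h1' h2', hpow, mul_assoc]
  gcongr
  exact hlin.trans (by gcongr)

theorem lsvLeft_eq {α u : ℝ} (hu : 0 ≤ u) : lsvLeft α u = u * (1 + (2 * u) ^ α) := by
  rw [lsvLeft, Real.mul_rpow zero_le_two hu]

theorem two_mul_rpow_le_one {α u : ℝ} (hα : 0 < α) (hu : u ∈ Ioc (0 : ℝ) (1 / 2)) :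
    (2 * u) ^ α ≤ 1 :=
  Real.rpow_le_one (by linarith [hu.1]) (by linarith [hu.2]) hα.le

theorem two_mul_rpow_monotoneOn {α : ℝ} (hα : 0 < α) :
    MonotoneOn (fun u : ℝ => (2 * u) ^ α) (Ioc 0 (1 / 2)) := fun a ha b _ hab =>
  Real.rpow_le_rpow (by linarith [ha.1]) (by linarith) hα.le

theorem isInverseBranch_lsvLeft {α : ℝ} (hα : 0 < α) {y : ℝ → ℝ}
    (hy : ∀ x ∈ Icc (0 : ℝ) 1, y x ∈ Icc (0 : ℝ) (1 / 2) ∧ lsvLeft α (y x) = x) :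
    IsInverseBranch (lsvLeft α) (fun u => 1 + (α + 1) * (2 * u) ^ α) y
      (Ioc 0 (1 / 2)) (Ioc 0 1) 1 where
  c_pos := one_pos
  mapsTo u hu := by
    have h1 := two_mul_rpow_le_one hα hu
    have h0 : 0 < (2 * u) ^ α := Real.rpow_pos_of_pos (by linarith [hu.1]) _
    rw [lsvLeft_eq hu.1.le]
    constructor
    · nlinarith [hu.1, mul_pos hu.1 h0]
    · nlinarith [hu.1, hu.2]
  mapsTo_inv x hx := by
    obtain ⟨⟨h0, h1⟩, h2⟩ := hy x ⟨hx.1.le, hx.2⟩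
    refine ⟨lt_of_le_of_ne h0 fun h => ?_, h1⟩
    rw [← h, lsvLeft, zero_mul] at h2
    exact hx.1.ne h2
  right_inv x hx := (hy x ⟨hx.1.le, hx.2⟩).2
  expand u hu v hv huv := by
    have h1 := two_mul_rpow_monotoneOn hα hu hv huv
    have h0 : 0 < (2 * u) ^ α := Real.rpow_pos_of_pos (by linarith [hu.1]) _
    have := mul_le_mul huv h1 h0.le hv.1.le
    rw [lsvLeft_eq hu.1.le, lsvLeft_eq hv.1.le]
    simp only at this
    linarith
  hasDerivAt u hu := by
    have h := (hasDerivAt_id u).mul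
      (((Real.hasDerivAt_rpow_const (p := α) (Or.inl hu.1.ne')).const_mul (2 ^ α)).const_add 1)
    refine h.congr_deriv ?_
    have : u ^ α = u ^ (α - 1) * u := by
      rw [← Real.rpow_add_one hu.1.ne']
      congr 1
      ring
    rw [Real.mul_rpow zero_le_two hu.1.le, this]
    simp only [id]
    ring
  D_pos u hu := by
    have : 0 < 2 * u := by linarith [hu.1]
    positivity
  D_mono a ha b hb hab := by
    have := two_mul_rpow_monotoneOn hα ha hb hab
    simp only at this ⊢
    gcongr
  D_cont := by
    refine continuousOn_const.add (continuousOn_const.mul ?_)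
    exact (by fun_prop : ContinuousOn (fun u : ℝ => 2 * u) _).rpow_const fun _ _ => Or.inr hα.le

theorem isInverseBranch_doubling :
    IsInverseBranch (fun u => 2 * u - 1) (fun _ => 2) (fun x => (x + 1) / 2)
      (Ioc (1 / 2) 1) (Ioc 0 1) 1 where
  c_pos := one_pos
  mapsTo u hu := ⟨by linarith [hu.1], by linarith [hu.2]⟩
  mapsTo_inv x hx := ⟨by linarith [hx.1], by linarith [hx.2]⟩
  right_inv x _ := by ring
  expand u _ v _ huv := by linarith
  hasDerivAt u _ := by simpa using ((hasDerivAt_id u).const_mul 2).sub_const 1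
  D_pos _ _ := two_pos
  D_mono := monotoneOn_const
  D_cont := continuousOn_const

theorem isInverseBranch_rRight {k : ℝ} (hk : k ∈ Ioo (0 : ℝ) 1) {z : ℝ → ℝ}
    (hz : ∀ x ∈ Ioc (1 / 2 : ℝ) 1, z x ∈ Ioc (1 / 2 : ℝ) 1 ∧
      1 / 2 + k * (z x - 1 / 2) + 2 * (1 - k) * (z x - 1 / 2) ^ 2 = x) :
    IsInverseBranch (fun u => 1 / 2 + k * (u - 1 / 2) + 2 * (1 - k) * (u - 1 / 2) ^ 2)
      (fun u => k + 4 * (1 - k) * (u - 1 / 2)) z (Ioc (1 / 2) 1) (Ioc (1 / 2) 1) k where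
  c_pos := hk.1
  mapsTo u hu := by
    have h0 : 0 < u - 1 / 2 := by linarith [hu.1]
    have h1 : u - 1 / 2 ≤ 1 / 2 := by linarith [hu.2]
    have h2 : 0 < 1 - k := by linarith [hk.2]
    have h3 : 0 < k := hk.1
    constructor
    · have : 0 < k * (u - 1 / 2) + 2 * (1 - k) * (u - 1 / 2) ^ 2 := by positivity
      linarith
    · have e1 : k * (u - 1 / 2) ≤ k * (1 / 2) := by gcongr
      have e2 : 2 * (1 - k) * (u - 1 / 2) ^ 2 ≤ 2 * (1 - k) * (1 / 2) ^ 2 := by gcongr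
      linarith
  mapsTo_inv x hx := (hz x hx).1
  right_inv x hx := (hz x hx).2
  expand u hu v _ huv := by
    have h0 : 0 ≤ u - 1 / 2 := by linarith [hu.1]
    have h2 : 0 ≤ 1 - k := by linarith [hk.2]
    have : 2 * (1 - k) * (u - 1 / 2) ^ 2 ≤ 2 * (1 - k) * (v - 1 / 2) ^ 2 := by gcongr
    linarith
  hasDerivAt u _ := by
    have h := (((hasDerivAt_id u).sub_const (1 / 2)).const_mul k).const_add (1 / 2)
    have h' := (((hasDerivAt_id u).sub_const (1 / 2)).pow 2).const_mul (2 * (1 - k))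
    refine (h.add h').congr_deriv ?_
    simp only [id]
    norm_num
    ring
  D_pos u hu := by
    have h0 : 0 < u - 1 / 2 := by linarith [hu.1]
    have h2 : 0 < 1 - k := by linarith [hk.2]
    have h3 : 0 < k := hk.1
    positivity
  D_mono a _ b _ hab := by
    have h2 : 0 ≤ 1 - k := by linarith [hk.2]
    simp only
    gcongr
  D_cont := by fun_prop

theorem sub_mul_le_setIntegral {f : ℝ → ℝ} {a b u : ℝ} (hf0 : ∀ x ∈ Ioc a b, 0 ≤ f x)
    (hf : AntitoneOn f (Ioc a b)) (hfi : IntegrableOn f (Ioc a b)) (hu : u ∈ Ioc a b) :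
    (u - a) * f u ≤ ∫ x in Ioc a b, f x := by
  have hsub : Ioc a u ⊆ Ioc a b := Ioc_subset_Ioc_right hu.2
  calc (u - a) * f u = ∫ _ in Ioc a u, f u := by
        rw [setIntegral_const, Real.volume_real_Ioc_of_le hu.1.le, smul_eq_mul]
    _ ≤ ∫ x in Ioc a u, f x :=
        setIntegral_mono_on (integrableOn_const (by simp)) (hfi.mono_set hsub) measurableSet_Ioc
          fun x hx => hf (hsub hx) hu hx.2
    _ ≤ ∫ x in Ioc a b, f x :=
        setIntegral_mono_set hfi ((ae_restrict_iff' measurableSet_Ioc).2 (ae_of_all _ hf0))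
          hsub.eventuallyLE

theorem monotoneOn_rpow_mul_lsvLeft_branch {α d : ℝ} (hα : 0 < α) (hd : α + 1 ≤ d) {y f : ℝ → ℝ}
    (hy : IsInverseBranch (lsvLeft α) (fun u => 1 + (α + 1) * (2 * u) ^ α) y
      (Ioc 0 (1 / 2)) (Ioc 0 1) 1)
    (hf0 : ∀ u ∈ Ioc (0 : ℝ) (1 / 2), 0 ≤ f u)
    (hf : MonotoneOn (fun u => u ^ d * f u) (Ioc 0 (1 / 2))) :
    MonotoneOn (fun x => x ^ d * (f (y x) / (1 + (α + 1) * (2 * y x) ^ α))) (Ioc 0 1) := by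
  refine hy.monotoneOn_weighted (w := fun u => u ^ d) (w' := fun x => x ^ d)
    (q := fun u => (1 + (2 * u) ^ α) ^ d / (1 + (α + 1) * (2 * u) ^ α))
    (fun u hu => mul_nonneg (Real.rpow_nonneg hu.1.le _) (hf0 u hu)) hf
    (fun u hu => ?_) (fun u hu v hv huv => ?_) (fun u hu => ?_)
  · have : 0 < 2 * u := by linarith [hu.1]
    positivity
  · have : 0 < 2 * u := by linarith [hu.1]
    exact rpow_add_div_le one_pos (by linarith) hd (by positivity)
      (two_mul_rpow_monotoneOn hα hu hv huv)
  · have : 0 < 2 * u := by linarith [hu.1]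
    have hD : 1 + (α + 1) * (2 * u) ^ α ≠ 0 := by positivity
    rw [div_mul_cancel₀ _ hD, lsvLeft_eq hu.1.le, Real.mul_rpow hu.1.le (by positivity)]

theorem monotoneOn_rpow_mul_doubling_branch {d : ℝ} {f : ℝ → ℝ}
    (hf0 : ∀ u ∈ Ioc (1 / 2 : ℝ) 1, 0 ≤ f u)
    (hf : MonotoneOn (fun u => (u - 1 / 2) ^ d * f u) (Ioc (1 / 2) 1)) :
    MonotoneOn (fun x : ℝ => x ^ d * (f ((x + 1) / 2) / 2)) (Ioc 0 1) := by
  refine isInverseBranch_doubling.monotoneOn_weighted (w := fun u => (u - 1 / 2) ^ d)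
    (w' := fun x => x ^ d) (q := fun _ => 2 ^ d / 2)
    (fun u hu => mul_nonneg (Real.rpow_nonneg (by linarith [hu.1]) _) (hf0 u hu)) hf
    (fun _ _ => by positivity) monotoneOn_const (fun u hu => ?_)
  rw [div_mul_cancel₀ _ two_ne_zero, ← Real.mul_rpow (by linarith [hu.1]) zero_le_two]
  congr 1
  ring

theorem monotoneOn_rpow_mul_rRight_branch {k d : ℝ} (hk : k ∈ Ioo (0 : ℝ) 1) (hd : 2 ≤ d)
    {z f : ℝ → ℝ}
    (hz : IsInverseBranch (fun u => 1 / 2 + k * (u - 1 / 2) + 2 * (1 - k) * (u - 1 / 2) ^ 2)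
      (fun u => k + 4 * (1 - k) * (u - 1 / 2)) z (Ioc (1 / 2) 1) (Ioc (1 / 2) 1) k)
    (hf0 : ∀ u ∈ Ioc (1 / 2 : ℝ) 1, 0 ≤ f u)
    (hf : MonotoneOn (fun u => (u - 1 / 2) ^ d * f u) (Ioc (1 / 2) 1)) :
    MonotoneOn (fun x => (x - 1 / 2) ^ d * (f (z x) / (k + 4 * (1 - k) * (z x - 1 / 2))))
      (Ioc (1 / 2) 1) := by
  have hk0 := hk.1
  have hk1 : 0 < 1 - k := by linarith [hk.2]
  refine hz.monotoneOn_weighted (w := fun u => (u - 1 / 2) ^ d) (w' := fun u => (u - 1 / 2) ^ d)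
    (q := fun u => (k + 2 * (1 - k) * (u - 1 / 2)) ^ d / (k + 4 * (1 - k) * (u - 1 / 2)))
    (fun u hu => mul_nonneg (Real.rpow_nonneg (by linarith [hu.1]) _) (hf0 u hu)) hf
    (fun u hu => ?_) (fun u hu v hv huv => ?_) (fun u hu => ?_)
  all_goals have hu0 : 0 < u - 1 / 2 := by linarith [hu.1]
  · positivity
  · have := rpow_add_div_le (w₁ := 2 * (1 - k) * (u - 1 / 2)) (w₂ := 2 * (1 - k) * (v - 1 / 2))
      hk0 one_le_two hd (by positivity) (by gcongr)
    simpa only [show ∀ v : ℝ, 2 * (2 * (1 - k) * v) = 4 * (1 - k) * v from fun v => by ring]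
      using this
  · have hD : k + 4 * (1 - k) * (u - 1 / 2) ≠ 0 := by positivity
    rw [div_mul_cancel₀ _ hD, ← Real.mul_rpow hu0.le (by positivity)]
    congr 1
    ring

theorem lsvLeft_branch_half_le {α : ℝ} (hα : 0 < α) {y : ℝ → ℝ}
    (hy : IsInverseBranch (lsvLeft α) (fun u => 1 + (α + 1) * (2 * u) ^ α) y
      (Ioc 0 (1 / 2)) (Ioc 0 1) 1) {x : ℝ} (hx : x ∈ Ioc (0 : ℝ) 1) : x / 2 ≤ y x := by
  have hu := hy.mapsTo_inv hx
  have hux := hy.right_inv x hx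
  have := two_mul_rpow_le_one hα hu
  rw [lsvLeft_eq hu.1.le] at hux
  nlinarith [hu.1]

theorem lsvLeft_branch_le {α t a : ℝ} (hα : 0 < α) (ht0 : 0 ≤ t) (ht1 : t ≤ 1) (ha : 0 ≤ a)
    {y f : ℝ → ℝ}
    (hy : IsInverseBranch (lsvLeft α) (fun u => 1 + (α + 1) * (2 * u) ^ α) y
      (Ioc 0 (1 / 2)) (Ioc 0 1) 1)
    (hf : ∀ u ∈ Ioc (0 : ℝ) (1 / 2), f u ≤ a * u ^ (-t)) {x : ℝ} (hx : x ∈ Ioc (0 : ℝ) 1) :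
    f (y x) / (1 + (α + 1) * (2 * y x) ^ α) ≤
      a * x ^ (-t) * (1 - (α + 1 - t) / (α + 2) * x ^ α) := by
  have hu := hy.mapsTo_inv hx
  have hux := hy.right_inv x hx
  have hhalf := lsvLeft_branch_half_le hα hy hx
  rw [lsvLeft_eq hu.1.le] at hux
  set u := y x
  have hξx : x ^ α ≤ (2 * u) ^ α := Real.rpow_le_rpow hx.1.le (by linarith) hα.le
  have hξ1 := two_mul_rpow_le_one hα hu
  have hξ0 : 0 < (2 * u) ^ α := Real.rpow_pos_of_pos (by linarith [hu.1]) _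
  set ξ := (2 * u) ^ α
  have hD : 0 < 1 + (α + 1) * ξ := by positivity
  have hxt : 0 < x ^ (-t) := Real.rpow_pos_of_pos hx.1 _
  have hut : u ^ (-t) = x ^ (-t) * (1 + ξ) ^ t := by
    have h1 : 0 < (1 + ξ) ^ t := by positivity
    rw [← hux, Real.mul_rpow hu.1.le (by linarith), Real.rpow_neg (by linarith : 0 ≤ 1 + ξ)]
    field_simp
  have hBer : (1 + ξ) ^ t ≤ 1 + t * ξ :=
    rpow_one_add_le_one_add_mul_self (by linarith) ht0 ht1
  set c := (α + 1 - t) / (α + 2) with hc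
  have hc0 : 0 ≤ c := div_nonneg (by linarith) (by linarith)
  have hcα : c * (α + 2) = α + 1 - t := div_mul_cancel₀ _ (by linarith)
  have hlin : 1 + t * ξ ≤ (1 - c * x ^ α) * (1 + (α + 1) * ξ) := by
    have e1 : c * x ^ α * (1 + (α + 1) * ξ) ≤ c * ξ * (α + 2) := by
      have : (α + 1) * ξ ≤ α + 1 := mul_le_of_le_one_right (by linarith) hξ1
      exact mul_le_mul (mul_le_mul_of_nonneg_left hξx hc0) (by linarith) hD.le
        (mul_nonneg hc0 hξ0.le)
    have e2 : c * ξ * (α + 2) = (α + 1 - t) * ξ := by rw [← hcα]; ring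
    linarith
  rw [div_le_iff₀ hD]
  calc f u ≤ a * u ^ (-t) := hf u hu
    _ = a * x ^ (-t) * (1 + ξ) ^ t := by rw [hut, mul_assoc]
    _ ≤ a * x ^ (-t) * ((1 - c * x ^ α) * (1 + (α + 1) * ξ)) := by
        gcongr
        exact hBer.trans hlin
    _ = _ := by ring

theorem doubling_branch_le {t a : ℝ} (ht1 : t ≤ 1) (ha : 0 ≤ a) {f : ℝ → ℝ}
    (hf : ∀ u ∈ Ioc (1 / 2 : ℝ) 1, f u ≤ a * (u - 1 / 2) ^ (-t)) {x : ℝ}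
    (hx : x ∈ Ioc (0 : ℝ) 1) : f ((x + 1) / 2) / 2 ≤ a * x ^ (-t) := by
  have h := hf ((x + 1) / 2) (isInverseBranch_doubling.mapsTo_inv hx)
  have e : ((x + 1) / 2 - 1 / 2) ^ (-t) = x ^ (-t) * 2 ^ t := by
    rw [show (x + 1) / 2 - 1 / 2 = x / 2 by ring, Real.div_rpow hx.1.le zero_le_two,
      Real.rpow_neg zero_le_two t, div_inv_eq_mul]
  have h2 : (2 : ℝ) ^ t ≤ 2 := by
    simpa using Real.rpow_le_rpow_of_exponent_le one_le_two ht1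
  have hxt : 0 < x ^ (-t) := Real.rpow_pos_of_pos hx.1 _
  rw [e] at h
  rw [div_le_iff₀ two_pos]
  calc _ ≤ _ := h
    _ ≤ a * (x ^ (-t) * 2) := by gcongr
    _ = _ := by ring

theorem rRight_branch_le {k t a : ℝ} (hk : k ∈ Ioo (0 : ℝ) 1) (ht1 : t ≤ 1) (ha : 0 ≤ a)
    {z f : ℝ → ℝ}
    (hz : IsInverseBranch (fun u => 1 / 2 + k * (u - 1 / 2) + 2 * (1 - k) * (u - 1 / 2) ^ 2)
      (fun u => k + 4 * (1 - k) * (u - 1 / 2)) z (Ioc (1 / 2) 1) (Ioc (1 / 2) 1) k)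
    (hf : ∀ u ∈ Ioc (1 / 2 : ℝ) 1, f u ≤ a * (u - 1 / 2) ^ (-t)) {x : ℝ}
    (hx : x ∈ Ioc (1 / 2 : ℝ) 1) :
    f (z x) / (k + 4 * (1 - k) * (z x - 1 / 2)) ≤ k ^ (t - 1) * (a * (x - 1 / 2) ^ (-t)) := by
  have hk0 := hk.1
  have hk1 : 0 < 1 - k := by linarith [hk.2]
  have hu := hz.mapsTo_inv hx
  have hux := hz.right_inv x hx
  have hfu := hf _ hu
  set v := z x - 1 / 2 with hv
  have hv0 : 0 < v := by linarith [hu.1]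
  have hxv : x - 1 / 2 = v * (k + 2 * (1 - k) * v) := by
    rw [← hux]
    ring
  set m := k + 2 * (1 - k) * v with hm
  have hkm : k ≤ m := by
    have : 0 ≤ 2 * (1 - k) * v := by positivity
    linarith
  have hm0 : 0 < m := by linarith
  have hmD : m ≤ k + 4 * (1 - k) * v := by
    have : 0 ≤ 2 * (1 - k) * v := by positivity
    linarith
  have hvt : v ^ (-t) = (x - 1 / 2) ^ (-t) * m ^ t := by
    have h1 : 0 < m ^ t := by positivity
    rw [hxv, Real.mul_rpow hv0.le hm0.le, Real.rpow_neg hm0.le]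
    field_simp
  have hx0 : 0 < (x - 1 / 2) ^ (-t) := Real.rpow_pos_of_pos (by linarith [hx.1]) _
  have hmt : m ^ t ≤ k ^ (t - 1) * m := by
    calc m ^ t = m ^ (t - 1) * m := by rw [← Real.rpow_add_one hm0.ne']; ring_nf
      _ ≤ k ^ (t - 1) * m := by
        gcongr ?_ * m
        exact Real.rpow_le_rpow_of_nonpos hk0 hkm (by linarith)
  have hkt : 0 < k ^ (t - 1) := Real.rpow_pos_of_pos hk0 _
  rw [div_le_iff₀ (hm0.trans_le hmD)]
  calc _ ≤ _ := hfu
    _ = a * (x - 1 / 2) ^ (-t) * m ^ t := by rw [hvt, mul_assoc]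
    _ ≤ a * (x - 1 / 2) ^ (-t) * (k ^ (t - 1) * (k + 4 * (1 - k) * v)) := by
        gcongr
        exact hmt.trans (by gcongr)
    _ = _ := by ring

/-- The part of `PFop` coming from the branches that map onto `(0, 1]`. -/
noncomputable def fullBranchSum {N : ℕ} (SR : Finset (Fin N)) (p α : Fin N → ℝ)
    (y : Fin N → ℝ → ℝ) (f : ℝ → ℝ) (x : ℝ) : ℝ :=
  (∑ j, p j * (f (y j x) / (1 + (α j + 1) * (2 * y j x) ^ (α j))))
    + (∑ j ∈ SRᶜ, p j) * (f ((x + 1) / 2) / 2)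

/-- The part of `PFop` coming from the branches that map `(1/2, 1]` to itself. -/
noncomputable def halfBranchSum {N : ℕ} (SR : Finset (Fin N)) (p K : Fin N → ℝ)
    (zr : Fin N → ℝ → ℝ) (f : ℝ → ℝ) (x : ℝ) : ℝ :=
  ∑ r ∈ SR, p r * (f (zr r x) / (K r + 4 * (1 - K r) * (zr r x - 1 / 2)))

section PFop

variable {N : ℕ} {SR : Finset (Fin N)} {p α K : Fin N → ℝ} {y zr : Fin N → ℝ → ℝ} {f : ℝ → ℝ}

theorem PFop_eqOn_left :
    EqOn (PFop SR p α K y zr f) (fullBranchSum SR p α y f) (Ioc 0 (1 / 2)) := fun x hx => by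
  simp only [PFop, if_neg (not_lt.2 hx.2), add_zero]
  rfl

theorem PFop_eqOn_right :
    EqOn (PFop SR p α K y zr f) (fun x => fullBranchSum SR p α y f x + halfBranchSum SR p K zr f x)
      (Ioc (1 / 2) 1) := fun x hx => by
  simp only [PFop, if_pos hx.1]
  rfl

theorem PFop_eqOn_indicator :
    EqOn (PFop SR p α K y zr f) (fun x => fullBranchSum SR p α y f x +
      (Ioc (1 / 2 : ℝ) 1).indicator (halfBranchSum SR p K zr f) x) (Ioc 0 1) := fun x hx => by
  by_cases h : 1 / 2 < x
  · have hx' : x ∈ Ioc (1 / 2 : ℝ) 1 := ⟨h, hx.2⟩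
    simp only [PFop_eqOn_right hx', indicator_of_mem hx']
  · have hx' : x ∉ Ioc (1 / 2 : ℝ) 1 := fun h' => h h'.1
    simp only [PFop_eqOn_left ⟨hx.1, not_lt.1 h⟩, indicator_of_notMem hx', add_zero]

end PFop

/-- A random system in which `y` and `zr` are the inverse branches, as used by `PFop`. -/
structure IsBranchSystem {N : ℕ} (SR : Finset (Fin N)) (p α K : Fin N → ℝ)
    (y zr : Fin N → ℝ → ℝ) : Prop where
  p_pos : ∀ j, 0 < p j
  p_sum : ∑ j, p j = 1
  α_pos : ∀ j, 0 < α j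
  K_mem : ∀ r ∈ SR, K r ∈ Ioo (0 : ℝ) 1
  left_branch : ∀ j, IsInverseBranch (lsvLeft (α j))
    (fun u => 1 + (α j + 1) * (2 * u) ^ α j) (y j) (Ioc 0 (1 / 2)) (Ioc 0 1) 1
  right_branch : ∀ r ∈ SR, IsInverseBranch
    (fun u => 1 / 2 + K r * (u - 1 / 2) + 2 * (1 - K r) * (u - 1 / 2) ^ 2)
    (fun u => K r + 4 * (1 - K r) * (u - 1 / 2)) (zr r) (Ioc (1 / 2) 1) (Ioc (1 / 2) 1) (K r)

namespace IsBranchSystem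

variable {N : ℕ} {SR : Finset (Fin N)} {p α K : Fin N → ℝ} {y zr : Fin N → ℝ → ℝ} {f : ℝ → ℝ}

theorem compl_sum_nonneg (h : IsBranchSystem SR p α K y zr) : 0 ≤ ∑ j ∈ SRᶜ, p j :=
  Finset.sum_nonneg fun j _ => (h.p_pos j).le

theorem compl_sum_add (h : IsBranchSystem SR p α K y zr) :
    (∑ j ∈ SRᶜ, p j) + ∑ r ∈ SR, p r = 1 := by
  rw [Finset.sum_compl_add_sum, h.p_sum]

theorem compl_sum_le_one (h : IsBranchSystem SR p α K y zr) : ∑ j ∈ SRᶜ, p j ≤ 1 := by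
  have := Finset.sum_nonneg fun r (_ : r ∈ SR) => (h.p_pos r).le
  linarith [h.compl_sum_add]

theorem fullBranchSum_nonneg (h : IsBranchSystem SR p α K y zr)
    (hf : ∀ x ∈ Ioc (0 : ℝ) 1, 0 ≤ f x) {x : ℝ} (hx : x ∈ Ioc (0 : ℝ) 1) :
    0 ≤ fullBranchSum SR p α y f x := by
  refine add_nonneg (Finset.sum_nonneg fun j _ => mul_nonneg (h.p_pos j).le ?_)
    (mul_nonneg h.compl_sum_nonneg ?_)
  · exact (h.left_branch j).nonneg (fun u hu => hf u ⟨hu.1, hu.2.trans (by norm_num)⟩) x hx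
  · exact isInverseBranch_doubling.nonneg (fun u hu => hf u ⟨by linarith [hu.1], hu.2⟩) x hx

theorem halfBranchSum_nonneg (h : IsBranchSystem SR p α K y zr)
    (hf : ∀ x ∈ Ioc (0 : ℝ) 1, 0 ≤ f x) {x : ℝ} (hx : x ∈ Ioc (1 / 2 : ℝ) 1) :
    0 ≤ halfBranchSum SR p K zr f x :=
  Finset.sum_nonneg fun r hr => mul_nonneg (h.p_pos r).le
    ((h.right_branch r hr).nonneg (fun u hu => hf u ⟨by linarith [hu.1], hu.2⟩) x hx)

theorem fullBranchSum_antitoneOn (h : IsBranchSystem SR p α K y zr) (hf : memC0 f) :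
    AntitoneOn (fullBranchSum SR p α y f) (Ioc 0 1) := by
  obtain ⟨hf0, hfl, -, hfr, -, -⟩ := hf
  intro a ha b hb hab
  refine add_le_add (Finset.sum_le_sum fun j _ => mul_le_mul_of_nonneg_left ?_ (h.p_pos j).le)
    (mul_le_mul_of_nonneg_left ?_ h.compl_sum_nonneg)
  · exact (h.left_branch j).antitoneOn (fun u hu => hf0 u ⟨hu.1, hu.2.trans (by norm_num)⟩) hfl
      ha hb hab
  · exact isInverseBranch_doubling.antitoneOn (fun u hu => hf0 u ⟨by linarith [hu.1], hu.2⟩) hfr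
      ha hb hab

theorem halfBranchSum_antitoneOn (h : IsBranchSystem SR p α K y zr) (hf : memC0 f) :
    AntitoneOn (halfBranchSum SR p K zr f) (Ioc (1 / 2) 1) := by
  obtain ⟨hf0, -, -, hfr, -, -⟩ := hf
  intro a ha b hb hab
  exact Finset.sum_le_sum fun r hr => mul_le_mul_of_nonneg_left
    ((h.right_branch r hr).antitoneOn (fun u hu => hf0 u ⟨by linarith [hu.1], hu.2⟩) hfr
      ha hb hab) (h.p_pos r).le

theorem fullBranchSum_continuousOn (h : IsBranchSystem SR p α K y zr) (hf : memC0 f) :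
    ContinuousOn (fullBranchSum SR p α y f) (Ioc 0 1) :=
  (continuousOn_finsetSum _ fun j _ =>
    continuousOn_const.mul ((h.left_branch j).continuousOn hf.2.2.1)).add
    (continuousOn_const.mul (isInverseBranch_doubling.continuousOn hf.2.2.2.2.1))

theorem halfBranchSum_continuousOn (h : IsBranchSystem SR p α K y zr) (hf : memC0 f) :
    ContinuousOn (halfBranchSum SR p K zr f) (Ioc (1 / 2) 1) :=
  continuousOn_finsetSum _ fun r hr =>
    continuousOn_const.mul ((h.right_branch r hr).continuousOn hf.2.2.2.2.1)

theorem _root_.memC0.integrableOn_left (hf : memC0 f) : IntegrableOn f (Ioc 0 (1 / 2)) :=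
  hf.2.2.2.2.2.mono_set (Ioc_subset_Ioc_right (by norm_num))

theorem _root_.memC0.integrableOn_right (hf : memC0 f) : IntegrableOn f (Ioc (1 / 2) 1) :=
  hf.2.2.2.2.2.mono_set (Ioc_subset_Ioc_left (by norm_num))

theorem _root_.memC0.integral_eq_add (hf : memC0 f) :
    ∫ x in Ioc (0 : ℝ) 1, f x =
      (∫ x in Ioc (0 : ℝ) (1 / 2), f x) + ∫ x in Ioc (1 / 2 : ℝ) 1, f x := by
  rw [← setIntegral_union (Ioc_disjoint_Ioc_of_le le_rfl) measurableSet_Ioc hf.integrableOn_left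
    hf.integrableOn_right, Ioc_union_Ioc_eq_Ioc (by norm_num) (by norm_num)]

theorem left_integrableOn (h : IsBranchSystem SR p α K y zr) (hf : memC0 f) (j : Fin N) :
    IntegrableOn (fun x => p j * (f (y j x) / (1 + (α j + 1) * (2 * y j x) ^ (α j)))) (Ioc 0 1) :=
  ((h.left_branch j).integrableOn measurableSet_Ioc hf.integrableOn_left).const_mul _

theorem doubling_integrableOn (hf : memC0 f) (q : ℝ) :
    IntegrableOn (fun x => q * (f ((x + 1) / 2) / 2)) (Ioc 0 1) :=
  (isInverseBranch_doubling.integrableOn measurableSet_Ioc hf.integrableOn_right).const_mul _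

theorem right_integrableOn (h : IsBranchSystem SR p α K y zr) (hf : memC0 f) {r : Fin N}
    (hr : r ∈ SR) :
    IntegrableOn (fun x => p r * (f (zr r x) / (K r + 4 * (1 - K r) * (zr r x - 1 / 2))))
      (Ioc (1 / 2) 1) :=
  ((h.right_branch r hr).integrableOn measurableSet_Ioc hf.integrableOn_right).const_mul _

theorem fullBranchSum_integrableOn (h : IsBranchSystem SR p α K y zr) (hf : memC0 f) :
    IntegrableOn (fullBranchSum SR p α y f) (Ioc 0 1) :=
  (integrable_finsetSum _ fun j _ => h.left_integrableOn hf j).add (doubling_integrableOn hf _)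

theorem halfBranchSum_integrableOn (h : IsBranchSystem SR p α K y zr) (hf : memC0 f) :
    IntegrableOn (halfBranchSum SR p K zr f) (Ioc (1 / 2) 1) :=
  integrable_finsetSum _ fun _ hr => h.right_integrableOn hf hr

theorem integral_fullBranchSum (h : IsBranchSystem SR p α K y zr) (hf : memC0 f) :
    ∫ x in Ioc (0 : ℝ) 1, fullBranchSum SR p α y f x =
      (∫ x in Ioc (0 : ℝ) (1 / 2), f x) +
        (∑ j ∈ SRᶜ, p j) * ∫ x in Ioc (1 / 2 : ℝ) 1, f x := by
  simp only [fullBranchSum]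
  rw [integral_add (integrable_finsetSum _ fun j _ => h.left_integrableOn hf j)
    (doubling_integrableOn hf _), integral_finsetSum _ fun j _ => h.left_integrableOn hf j,
    integral_const_mul, isInverseBranch_doubling.integral_eq measurableSet_Ioc]
  congr 1
  calc _ = ∑ j, p j * ∫ x in Ioc (0 : ℝ) (1 / 2), f x := Finset.sum_congr rfl fun j _ => by
        rw [integral_const_mul, (h.left_branch j).integral_eq measurableSet_Ioc]
    _ = _ := by rw [← Finset.sum_mul, h.p_sum, one_mul]

theorem integral_halfBranchSum (h : IsBranchSystem SR p α K y zr) (hf : memC0 f) :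
    ∫ x in Ioc (1 / 2 : ℝ) 1, halfBranchSum SR p K zr f x =
      (∑ r ∈ SR, p r) * ∫ x in Ioc (1 / 2 : ℝ) 1, f x := by
  simp only [halfBranchSum]
  rw [integral_finsetSum _ fun r hr => h.right_integrableOn hf hr, Finset.sum_mul]
  exact Finset.sum_congr rfl fun r hr => by
    rw [integral_const_mul, (h.right_branch r hr).integral_eq measurableSet_Ioc]

theorem indicator_integrableOn (h : IsBranchSystem SR p α K y zr) (hf : memC0 f) :
    IntegrableOn ((Ioc (1 / 2 : ℝ) 1).indicator (halfBranchSum SR p K zr f)) (Ioc 0 1) :=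
  ((h.halfBranchSum_integrableOn hf).integrable_indicator measurableSet_Ioc).integrableOn

theorem integrableOn_PFop (h : IsBranchSystem SR p α K y zr) (hf : memC0 f) :
    IntegrableOn (PFop SR p α K y zr f) (Ioc 0 1) :=
  ((h.fullBranchSum_integrableOn hf).add (h.indicator_integrableOn hf)).congr_fun
    PFop_eqOn_indicator.symm measurableSet_Ioc

theorem integral_PFop (h : IsBranchSystem SR p α K y zr) (hf : memC0 f) :
    ∫ x in Ioc (0 : ℝ) 1, PFop SR p α K y zr f x = ∫ x in Ioc (0 : ℝ) 1, f x := by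
  rw [setIntegral_congr_fun measurableSet_Ioc PFop_eqOn_indicator,
    integral_add (h.fullBranchSum_integrableOn hf) (h.indicator_integrableOn hf),
    setIntegral_indicator measurableSet_Ioc,
    inter_eq_self_of_subset_right (Ioc_subset_Ioc_left (by norm_num)),
    h.integral_fullBranchSum hf, h.integral_halfBranchSum hf, hf.integral_eq_add, add_assoc,
    ← add_mul, h.compl_sum_add, one_mul]

theorem memC0_PFop (h : IsBranchSystem SR p α K y zr) (hf : memC0 f) :
    memC0 (PFop SR p α K y zr f) := by
  have hl : Ioc (0 : ℝ) (1 / 2) ⊆ Ioc 0 1 := Ioc_subset_Ioc_right (by norm_num)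
  have hr : Ioc (1 / 2 : ℝ) 1 ⊆ Ioc 0 1 := Ioc_subset_Ioc_left (by norm_num)
  refine ⟨fun x hx => ?_, ?_, ?_, ?_, ?_, h.integrableOn_PFop hf⟩
  · rw [PFop_eqOn_indicator hx]
    exact add_nonneg (h.fullBranchSum_nonneg hf.1 hx)
      (indicator_nonneg (fun x hx => h.halfBranchSum_nonneg hf.1 hx) x)
  · exact ((h.fullBranchSum_antitoneOn hf).mono hl).congr PFop_eqOn_left.symm
  · exact ((h.fullBranchSum_continuousOn hf).mono hl).congr PFop_eqOn_left
  · exact (((h.fullBranchSum_antitoneOn hf).mono hr).add (h.halfBranchSum_antitoneOn hf)).congr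
      PFop_eqOn_right.symm
  · exact (((h.fullBranchSum_continuousOn hf).mono hr).add
      (h.halfBranchSum_continuousOn hf)).congr PFop_eqOn_right

theorem fullBranchSum_monotoneOn_weighted (h : IsBranchSystem SR p α K y zr) {d : ℝ}
    (hd : ∀ j, α j + 1 ≤ d) (hf : memC1 d f) :
    MonotoneOn (fun x => x ^ d * fullBranchSum SR p α y f x) (Ioc 0 1) := by
  obtain ⟨⟨hf0, -⟩, hfl, hfr⟩ := hf
  intro a ha b hb hab
  simp only [fullBranchSum, mul_add, Finset.mul_sum, mul_left_comm (_ ^ d) (p _),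
    mul_left_comm (_ ^ d) (∑ j ∈ SRᶜ, p j)]
  refine add_le_add (Finset.sum_le_sum fun j _ => mul_le_mul_of_nonneg_left ?_ (h.p_pos j).le)
    (mul_le_mul_of_nonneg_left ?_ h.compl_sum_nonneg)
  · exact monotoneOn_rpow_mul_lsvLeft_branch (h.α_pos j) (hd j) (h.left_branch j)
      (fun u hu => hf0 u ⟨hu.1, hu.2.trans (by norm_num)⟩) hfl ha hb hab
  · exact monotoneOn_rpow_mul_doubling_branch (fun u hu => hf0 u ⟨by linarith [hu.1], hu.2⟩) hfr
      ha hb hab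

theorem halfBranchSum_monotoneOn_weighted (h : IsBranchSystem SR p α K y zr) {d : ℝ}
    (hd : 2 ≤ d) (hf : memC1 d f) :
    MonotoneOn (fun x => (x - 1 / 2) ^ d * halfBranchSum SR p K zr f x) (Ioc (1 / 2) 1) := by
  obtain ⟨⟨hf0, -⟩, -, hfr⟩ := hf
  intro a ha b hb hab
  simp only [halfBranchSum, Finset.mul_sum, mul_left_comm (_ ^ d) (p _)]
  exact Finset.sum_le_sum fun r hr => mul_le_mul_of_nonneg_left
    (monotoneOn_rpow_mul_rRight_branch (h.K_mem r hr) hd (h.right_branch r hr)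
      (fun u hu => hf0 u ⟨by linarith [hu.1], hu.2⟩) hfr ha hb hab) (h.p_pos r).le

theorem memC1_PFop (h : IsBranchSystem SR p α K y zr) {d : ℝ} (hd : ∀ j, α j + 1 ≤ d)
    (hd2 : 2 ≤ d) (hf : memC1 d f) : memC1 d (PFop SR p α K y zr f) := by
  have hG := h.fullBranchSum_monotoneOn_weighted hd hf
  have hl : Ioc (0 : ℝ) (1 / 2) ⊆ Ioc 0 1 := Ioc_subset_Ioc_right (by norm_num)
  have hr : Ioc (1 / 2 : ℝ) 1 ⊆ Ioc 0 1 := Ioc_subset_Ioc_left (by norm_num)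
  refine ⟨h.memC0_PFop hf.1, (hG.mono hl).congr fun x hx => ?_, fun a ha b hb hab => ?_⟩
  · simp only [PFop_eqOn_left hx]
  · have hH := h.halfBranchSum_monotoneOn_weighted hd2 hf ha hb hab
    have hG' := hG (hr ha) (hr hb) hab
    simp only [PFop_eqOn_right ha, PFop_eqOn_right hb, mul_add] at hH hG' ⊢
    refine add_le_add ?_ hH
    have ha0 : 0 < a := (hr ha).1
    have hb0 : 0 < b := (hr hb).1
    have ha1 : 0 ≤ a - 1 / 2 := by linarith [ha.1]
    have hb1 : 0 ≤ b - 1 / 2 := by linarith [hb.1]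
    have hfac : ∀ x : ℝ, 0 < x → 0 ≤ x - 1 / 2 →
        (x - 1 / 2) ^ d = ((x - 1 / 2) / x) ^ d * x ^ d := fun x hx0 hx1 => by
      rw [← Real.mul_rpow (by positivity) hx0.le, div_mul_cancel₀ _ hx0.ne']
    rw [hfac a ha0 ha1, hfac b hb0 hb1, mul_assoc, mul_assoc]
    refine mul_le_mul ?_ hG' (mul_nonneg (by positivity) (h.fullBranchSum_nonneg hf.1.1 (hr ha)))
      (by positivity)
    refine Real.rpow_le_rpow (by positivity) ?_ (by linarith)
    rw [div_le_div_iff₀ ha0 hb0]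
    linarith

theorem fullBranchSum_le_of_integral (h : IsBranchSystem SR p α K y zr) (hf : memC0 f)
    (hf1 : ∫ x in Ioc (0 : ℝ) 1, f x = 1) {x : ℝ} (hx : x ∈ Ioc (1 / 2 : ℝ) 1) :
    fullBranchSum SR p α y f x ≤ 6 := by
  have hx' : x ∈ Ioc (0 : ℝ) 1 := ⟨by linarith [hx.1], hx.2⟩
  have hl0 : ∀ u ∈ Ioc (0 : ℝ) (1 / 2), 0 ≤ f u :=
    fun u hu => hf.1 u ⟨hu.1, hu.2.trans (by norm_num)⟩
  have hr0 : ∀ u ∈ Ioc (1 / 2 : ℝ) 1, 0 ≤ f u := fun u hu => hf.1 u ⟨by linarith [hu.1], hu.2⟩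
  have hIl := setIntegral_nonneg (μ := volume) measurableSet_Ioc hl0
  have hIr := setIntegral_nonneg (μ := volume) measurableSet_Ioc hr0
  have hI := hf.integral_eq_add
  have hL : ∀ j, f (y j x) / (1 + (α j + 1) * (2 * y j x) ^ (α j)) ≤ 4 := fun j => by
    have hu := (h.left_branch j).mapsTo_inv hx'
    have hmass := sub_mul_le_setIntegral hl0 hf.2.1 hf.integrableOn_left hu
    have hhalf := lsvLeft_branch_half_le (h.α_pos j) (h.left_branch j) hx'
    have hfu := hl0 _ hu
    have hpos : 0 < 2 * y j x := by linarith [hu.1]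
    have hαj := h.α_pos j
    have hD : 1 ≤ 1 + (α j + 1) * (2 * y j x) ^ (α j) := le_add_of_nonneg_right (by positivity)
    refine (div_le_self hfu hD).trans ?_
    nlinarith [hx.1]
  have hM : f ((x + 1) / 2) / 2 ≤ 2 := by
    have hmass := sub_mul_le_setIntegral hr0 hf.2.2.2.1 hf.integrableOn_right
      (isInverseBranch_doubling.mapsTo_inv hx')
    have := hr0 _ (isInverseBranch_doubling.mapsTo_inv hx')
    nlinarith [hx.1]
  have hsum : ∑ j, p j * (f (y j x) / (1 + (α j + 1) * (2 * y j x) ^ (α j))) ≤ ∑ j, p j * 4 :=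
    Finset.sum_le_sum fun j _ => mul_le_mul_of_nonneg_left (hL j) (h.p_pos j).le
  rw [← Finset.sum_mul, h.p_sum] at hsum
  have := mul_le_mul h.compl_sum_le_one hM
    (isInverseBranch_doubling.nonneg hr0 x hx') zero_le_one
  simp only [fullBranchSum]
  linarith

theorem PFop_le_right (h : IsBranchSystem SR p α K y zr) (hf : memC0 f)
    (hf1 : ∫ x in Ioc (0 : ℝ) 1, f x = 1) {t a : ℝ} (ht0 : 0 ≤ t) (ht1 : t ≤ 1) (ha0 : 0 ≤ a)
    (ha : 6 ≤ (1 - ∑ r ∈ SR, p r * K r ^ (t - 1)) * a)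
    (hfa : ∀ u ∈ Ioc (1 / 2 : ℝ) 1, f u ≤ a * (u - 1 / 2) ^ (-t)) {x : ℝ}
    (hx : x ∈ Ioc (1 / 2 : ℝ) 1) : PFop SR p α K y zr f x ≤ a * (x - 1 / 2) ^ (-t) := by
  have hG := h.fullBranchSum_le_of_integral hf hf1 hx
  have hH : halfBranchSum SR p K zr f x ≤
      (∑ r ∈ SR, p r * K r ^ (t - 1)) * (a * (x - 1 / 2) ^ (-t)) := by
    rw [Finset.sum_mul]
    refine Finset.sum_le_sum fun r hr => ?_
    rw [mul_assoc (p r)]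
    exact mul_le_mul_of_nonneg_left
      (rRight_branch_le (h.K_mem r hr) ht1 ha0 (h.right_branch r hr) hfa hx) (h.p_pos r).le
  have hone : 1 ≤ (x - 1 / 2) ^ (-t) :=
    Real.one_le_rpow_of_pos_of_le_one_of_nonpos (by linarith [hx.1]) (by linarith [hx.2])
      (by linarith)
  rw [PFop_eqOn_right hx]
  nlinarith

theorem PFop_le_left (h : IsBranchSystem SR p α K y zr) {t₁ t₂ a₁ a₂ : ℝ} {i : Fin N}
    (ht₁0 : 0 ≤ t₁) (ht₁1 : t₁ ≤ 1) (ht₂1 : t₂ ≤ 1) (ht : t₁ = α i + t₂) (ha₁ : 0 ≤ a₁)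
    (ha₂ : 0 ≤ a₂) (ha : a₂ ≤ p i * ((1 - t₂) / (α i + 2)) * a₁)
    (hfl : ∀ u ∈ Ioc (0 : ℝ) (1 / 2), f u ≤ a₁ * u ^ (-t₁))
    (hfr : ∀ u ∈ Ioc (1 / 2 : ℝ) 1, f u ≤ a₂ * (u - 1 / 2) ^ (-t₂)) {x : ℝ}
    (hx : x ∈ Ioc (0 : ℝ) (1 / 2)) : PFop SR p α K y zr f x ≤ a₁ * x ^ (-t₁) := by
  have hx' : x ∈ Ioc (0 : ℝ) 1 := ⟨hx.1, hx.2.trans (by norm_num)⟩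
  have hL := fun j => lsvLeft_branch_le (h.α_pos j) ht₁0 ht₁1 ha₁ (h.left_branch j) hfl hx'
  have hM := doubling_branch_le ht₂1 ha₂ hfr hx'
  have hx0 : 0 < x ^ (-t₁) := Real.rpow_pos_of_pos hx.1 _
  have hx2 : 0 < x ^ (-t₂) := Real.rpow_pos_of_pos hx.1 _
  have hpow : x ^ (-t₁) * x ^ α i = x ^ (-t₂) := by
    rw [← Real.rpow_add hx.1, ht]
    congr 1
    ring
  set L := fun j => f (y j x) / (1 + (α j + 1) * (2 * y j x) ^ (α j)) with hLdef
  have hgap : ∀ j, 0 ≤ p j * (a₁ * x ^ (-t₁) - L j) := fun j => by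
    have hαj := h.α_pos j
    have hxα : 0 < x ^ α j := Real.rpow_pos_of_pos hx.1 _
    refine mul_nonneg (h.p_pos j).le (sub_nonneg.2 ((hL j).trans ?_))
    refine mul_le_of_le_one_right (by positivity) (sub_le_self _ ?_)
    exact mul_nonneg (div_nonneg (by linarith) (by linarith)) hxα.le
  have hsum := Finset.single_le_sum (fun j _ => hgap j) (Finset.mem_univ i)
  have hexp : ∑ j, p j * (a₁ * x ^ (-t₁) - L j) = a₁ * x ^ (-t₁) - ∑ j, p j * L j := by
    simp only [mul_sub, Finset.sum_sub_distrib, ← Finset.sum_mul, h.p_sum, one_mul]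
  have hi : p i * ((1 - t₂) / (α i + 2)) * a₁ * x ^ (-t₂) ≤ p i * (a₁ * x ^ (-t₁) - L i) := by
    have := mul_le_mul_of_nonneg_left (hL i) (h.p_pos i).le
    rw [show α i + 1 - t₁ = 1 - t₂ by rw [ht]; ring] at this
    rw [← hpow]
    linarith
  have hS := mul_le_mul_of_nonneg_right h.compl_sum_le_one (by positivity : 0 ≤ a₂ * x ^ (-t₂))
  have hM' := mul_le_mul_of_nonneg_left hM h.compl_sum_nonneg
  have hfin := mul_le_mul_of_nonneg_right ha hx2.le
  have hPF : PFop SR p α K y zr f x =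
      (∑ j, p j * L j) + (∑ j ∈ SRᶜ, p j) * (f ((x + 1) / 2) / 2) := PFop_eqOn_left hx
  rw [hPF]
  linarith

end IsBranchSystem

theorem sum_mul_rpow_neg_lt_one_of_lt_sSup {ι : Type*} {s : Finset ι} {p K : ι → ℝ}
    (hp : ∀ r ∈ s, 0 ≤ p r) (hK : ∀ r ∈ s, K r ∈ Ioo (0 : ℝ) 1) {β δ₀ : ℝ}
    (hδ₀ : 0 ≤ δ₀) (hδ₀1 : ∑ r ∈ s, p r * K r ^ (-δ₀) < 1)
    (hβ : β < sSup {δ : ℝ | 0 ≤ δ ∧ ∑ r ∈ s, p r * K r ^ (-δ) < 1}) :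
    ∑ r ∈ s, p r * K r ^ (-β) < 1 := by
  have hne : {δ : ℝ | 0 ≤ δ ∧ ∑ r ∈ s, p r * K r ^ (-δ) < 1}.Nonempty := ⟨δ₀, hδ₀, hδ₀1⟩
  obtain ⟨δ, ⟨-, hδ⟩, hβδ⟩ := exists_lt_of_lt_csSup hne hβ
  refine (Finset.sum_le_sum fun r hr => mul_le_mul_of_nonneg_left ?_ (hp r hr)).trans_lt hδ
  exact Real.rpow_le_rpow_of_exponent_ge (hK r hr).1 (hK r hr).2.le (by linarith)

/-- Lemma 3.4: for sufficiently large `a₁, a₂ > 0` the Perron–Frobenius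
operator `P` preserves the set `C₂(a₁,a₂,β)`. -/
theorem PFop_preserves_C2
    (N : ℕ) (hN : 0 < N)
    (α K : Fin N → ℝ) (SR : Finset (Fin N))
    (hSR : SR.Nonempty) (hSS : SRᶜ.Nonempty)
    (hα : ∀ j, 0 < α j)
    (hK : ∀ r ∈ SR, K r ∈ Set.Ioo (0 : ℝ) 1)
    (p : Fin N → ℝ) (hp : ∀ j, 0 < p j) (hp1 : ∑ j, p j = 1)
    (αmin : ℝ) (hαmin : IsLeast (Set.range α) αmin) (hαmin1 : αmin < 1)
    (αmax : ℝ) (hαmax : IsGreatest (Set.range α) αmax)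
    (d : ℝ) (hd : d = αmax + 2)
    (hη : ∑ r ∈ SR, p r * K r ^ (-αmin) < 1)
    (γ : ℝ) (hγ : γ = sSup {δ : ℝ | 0 ≤ δ ∧ ∑ r ∈ SR, p r * K r ^ (-δ) < 1})
    (β : ℝ) (hβ1 : αmin < β) (hβ2 : β < γ) (hβ3 : 0 < β) (hβ4 : β ≤ 1)
    (y : Fin N → ℝ → ℝ)
    (hy : ∀ j, ∀ x ∈ Set.Icc (0 : ℝ) 1,
      y j x ∈ Set.Icc (0 : ℝ) (1 / 2) ∧ lsvLeft (α j) (y j x) = x)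
    (zr : Fin N → ℝ → ℝ)
    (hzr : ∀ r ∈ SR, ∀ x ∈ Set.Ioc (1 / 2 : ℝ) 1,
      zr r x ∈ Set.Ioc (1 / 2 : ℝ) 1 ∧
        1 / 2 + K r * (zr r x - 1 / 2) + 2 * (1 - K r) * (zr r x - 1 / 2) ^ 2 = x) :
    ∃ A₂ > (0 : ℝ), ∀ a₂ ≥ A₂, ∃ A₁ > (0 : ℝ), ∀ a₁ ≥ A₁,
      ∀ f : ℝ → ℝ, memC2 d (αmin + 1 - β) (1 - β) a₁ a₂ f →
        memC2 d (αmin + 1 - β) (1 - β) a₁ a₂ (PFop SR p α K y zr f) := by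
  obtain ⟨⟨i, hi⟩, -⟩ := hαmin
  have h : IsBranchSystem SR p α K y zr :=
    ⟨hp, hp1, hα, hK, fun j => isInverseBranch_lsvLeft (hα j) (hy j),
      fun r hr => isInverseBranch_rRight (hK r hr) (hzr r hr)⟩
  have hαmin0 : 0 < αmin := hi ▸ hα i
  have hηβ : ∑ r ∈ SR, p r * K r ^ (-β) < 1 :=
    sum_mul_rpow_neg_lt_one_of_lt_sSup (fun r _ => (hp r).le) hK hαmin0.le hη (hγ ▸ hβ2)
  have hdα : ∀ j, α j + 2 ≤ d := fun j => by
    rw [hd]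
    linarith [hαmax.2 (mem_range_self j)]
  have hgap : 0 < 1 - ∑ r ∈ SR, p r * K r ^ (-β) := by linarith
  refine ⟨6 / (1 - ∑ r ∈ SR, p r * K r ^ (-β)), by positivity, fun a₂ ha₂ => ?_⟩
  have ha₂0 : 0 < a₂ := lt_of_lt_of_le (by positivity) ha₂
  have hc : 0 < p i * (β / (α i + 2)) :=
    mul_pos (hp i) (div_pos hβ3 (by linarith [hα i]))
  refine ⟨a₂ / (p i * (β / (α i + 2))), by positivity, fun a₁ ha₁ f hf => ?_⟩
  have ha₁0 : 0 < a₁ := lt_of_lt_of_le (by positivity) ha₁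
  obtain ⟨hfC, hfl, hfr, hf1⟩ := hf
  refine ⟨h.memC1_PFop (fun j => by linarith [hdα j]) (by linarith [hdα i, hα i]) hfC,
    fun x hx => ?_, fun x hx => ?_, (h.integral_PFop hfC.1).trans hf1⟩
  · refine h.PFop_le_left (i := i) (by linarith) (by linarith) (by linarith) (by rw [hi]; ring)
      ha₁0.le ha₂0.le ?_ hfl hfr hx
    rw [sub_sub_cancel, mul_comm]
    exact (div_le_iff₀ hc).1 ha₁
  · refine h.PFop_le_right hfC.1 hf1 (by linarith) (by linarith) ha₂0.le ?_ hfr hx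
    rw [show 1 - β - 1 = -β by ring, mul_comm]
    exact (div_le_iff₀ hgap).1 ha₂
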